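/- Let ℱ be any construction scheme on ω₁. Then the map α ↦ Ξ_α (regarded as an element of ℤ^ω) is injective, and the uncountable set 𝔼^ℱ = {Ξ_α : α < ω₁}, with the lexicographic order on ℤ^ω, is not 2-entangled: there is an uncountable family of pairwise disjoint 2-element subsets of 𝔼^ℱ no two distinct members of which realize the type τ = (0,1) nor the type τ¹ = (1,0). -/

import Mathlib

noncomputable section

open scoped Classical

/-- The first uncountable ordinal. -/
def omegaOne : Ordinal := (Cardinal.aleph 1).ord

/-- A scheme type. -/
structure SchemeType where
  m : ℕ → ℕ
  n : ℕ → ℕ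
  r : ℕ → ℕ
  m_zero : m 0 = 1
  n_ge : ∀ k, 2 ≤ n (k + 1)
  r_lt : ∀ k, r (k + 1) < m k
  m_succ : ∀ k, m (k + 1) = r (k + 1) + (m k - r (k + 1)) * n (k + 1)

/-- `A` is an initial segment of `B`. -/
def InitSeg (A B : Finset Ordinal) : Prop := ∀ a ∈ A, ∀ b ∈ B, b < a → b ∈ A

/-- `D`, `R` form the canonical decomposition of `F ∈ ℱ_{k+1}`. -/
def IsDecomposition (T : SchemeType) (ℱ : Set (Finset Ordinal)) (k : ℕ)
    (F : Finset Ordinal) (D : ℕ → Finset Ordinal) (R : Finset Ordinal) : Prop :=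
  (∀ i < T.n (k + 1), D i ∈ ℱ ∧ (D i).card = T.m k) ∧
  F = (Finset.range (T.n (k + 1))).biUnion D ∧
  R.card = T.r (k + 1) ∧
  (∀ i < T.n (k + 1), ∀ j < T.n (k + 1), i ≠ j → D i ∩ D j = R) ∧
  (∀ i < T.n (k + 1), ∀ x ∈ R, ∀ y ∈ D i \ R, x < y) ∧
  (∀ i j, i < j → j < T.n (k + 1) → ∀ x ∈ D i \ R, ∀ y ∈ D j \ R, x < y)

/-- `ℱ` is a construction scheme of type `T` on `ω₁`. -/
structure IsConstructionScheme (T : SchemeType) (ℱ : Set (Finset Ordinal)) : Prop where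
  nonempty_mem : ∀ F ∈ ℱ, F.Nonempty
  mem_subset : ∀ F ∈ ℱ, ↑F ⊆ Set.Iio omegaOne
  cofinal : ∀ A : Finset Ordinal, ↑A ⊆ Set.Iio omegaOne → ∃ F ∈ ℱ, A ⊆ F
  card_eq : ∀ F ∈ ℱ, ∃ k, F.card = T.m k
  inter_initSeg : ∀ k : ℕ, ∀ E ∈ ℱ, ∀ F ∈ ℱ, E.card = T.m k → F.card = T.m k →
    InitSeg (E ∩ F) E ∧ InitSeg (E ∩ F) F
  decomp : ∀ k : ℕ, ∀ F ∈ ℱ, F.card = T.m (k + 1) → ∃ D R, IsDecomposition T ℱ k F D R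

/-- `ρ(α,β)`: least `k` such that `{α,β}` is included in a member of `ℱ_k`. -/
def rho (T : SchemeType) (ℱ : Set (Finset Ordinal)) (α β : Ordinal) : ℕ :=
  sInf {k | ∃ F ∈ ℱ, F.card = T.m k ∧ α ∈ F ∧ β ∈ F}

/-- `‖α‖_k`, the cardinality of `(α)_k \ {α}`. -/
def nrm (T : SchemeType) (ℱ : Set (Finset Ordinal)) (α : Ordinal) (k : ℕ) : ℕ :=
  Set.ncard {ξ : Ordinal | ξ < α ∧ rho T ℱ α ξ ≤ k}

/-- `Δ(α,β)`: least `k` with `‖α‖_k ≠ ‖β‖_k`. -/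
def deltaOrd (T : SchemeType) (ℱ : Set (Finset Ordinal)) (α β : Ordinal) : ℕ :=
  sInf {k | nrm T ℱ α k ≠ nrm T ℱ β k}

/-- `Ξ_α(k)`. -/
def Xi (T : SchemeType) (ℱ : Set (Finset Ordinal)) (α : Ordinal) (k : ℕ) : ℤ :=
  if k = 0 then 0
  else if h : ∃ i : ℕ, ∃ F ∈ ℱ, ∃ D R, F.card = T.m k ∧ α ∈ F ∧
      IsDecomposition T ℱ (k - 1) F D R ∧ i < T.n k ∧ α ∈ D i ∧ α ∉ R
  then (h.choose : ℤ) else -1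

/-- The `a`-th element of a finite set of ordinals, in increasing order. -/
def elt (A : Finset Ordinal) (a : ℕ) : Ordinal := (A.sort (· ≤ ·)).getD a 0

/-- The family `⟨D_0, …, D_{j-1}⟩` is Δ-captured at level `l`. -/
def DeltaCapturedFam (T : SchemeType) (ℱ : Set (Finset Ordinal)) (j : ℕ)
    (D : ℕ → Finset Ordinal) (l : ℕ) : Prop :=
  ∃ R : Finset Ordinal,
    (∀ i < j, ∀ i' < j, (D i).card = (D i').card) ∧
    (∀ i < j, ∀ i' < j, i ≠ i' → D i ∩ D i' = R) ∧
    (∀ i < j, ∀ x ∈ R, ∀ y ∈ D i \ R, x < y) ∧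
    (∀ i i', i < i' → i' < j → ∀ x ∈ D i \ R, ∀ y ∈ D i' \ R, x < y) ∧
    (∀ i < j, ∀ a < R.card, Xi T ℱ (elt (D i) a) l = -1) ∧
    (∀ i < j, ∀ a, R.card ≤ a → a < (D i).card → Xi T ℱ (elt (D i) a) l = (i : ℤ)) ∧
    (∀ i < j, ∀ i' < j, i ≠ i' → ∀ a, R.card ≤ a → a < (D i).card →
      deltaOrd T ℱ (elt (D i) a) (elt (D i') a) = l)

/-- The family `⟨D_0, …, D_{j-1}⟩` is captured at level `l`. -/
def CapturedFam (T : SchemeType) (ℱ : Set (Finset Ordinal)) (j : ℕ)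
    (D : ℕ → Finset Ordinal) (l : ℕ) : Prop :=
  DeltaCapturedFam T ℱ j D l ∧
  ∀ i < j, ∀ i' < j, i ≠ i' → ∀ a, (D i ∩ D i').card ≤ a → a < (D i).card →
    rho T ℱ (elt (D i) a) (elt (D i') a) = l

/-- The ordered pair `⟨A, B⟩`, as a family. -/
def pairFam (A B : Finset Ordinal) : ℕ → Finset Ordinal := fun i => if i = 0 then A else B

/-- A pair of ordinals `α < β` is captured at level `l`, i.e. `⟨{α},{β}⟩` is. -/
def CapturedPair (T : SchemeType) (ℱ : Set (Finset Ordinal)) (α β : Ordinal) (l : ℕ) : Prop :=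
  α < β ∧ Xi T ℱ α l = 0 ∧ Xi T ℱ β l = 1 ∧ deltaOrd T ℱ α β = l ∧ rho T ℱ α β = l

/-- `ℱ` is a 2-Δ-capturing scheme. -/
def TwoDeltaCapturing (T : SchemeType) (ℱ : Set (Finset Ordinal)) : Prop :=
  ∀ 𝒮 : Set (Finset Ordinal), (∀ A ∈ 𝒮, A.Nonempty ∧ ↑A ⊆ Set.Iio omegaOne) →
    ¬ 𝒮.Countable →
    {l : ℕ | ∃ A ∈ 𝒮, ∃ B ∈ 𝒮, A ≠ B ∧ DeltaCapturedFam T ℱ 2 (pairFam A B) l}.Infinite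

/-- `ℱ` is a 2-capturing scheme. -/
def TwoCapturing (T : SchemeType) (ℱ : Set (Finset Ordinal)) : Prop :=
  ∀ 𝒮 : Set (Finset Ordinal), (∀ A ∈ 𝒮, A.Nonempty ∧ ↑A ⊆ Set.Iio omegaOne) →
    ¬ 𝒮.Countable →
    {l : ℕ | ∃ A ∈ 𝒮, ∃ B ∈ 𝒮, A ≠ B ∧ CapturedFam T ℱ 2 (pairFam A B) l}.Infinite

/-- `ℱ` is a fully Δ-capturing scheme. -/
def FullyDeltaCapturing (T : SchemeType) (ℱ : Set (Finset Ordinal)) : Prop :=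
  ∀ 𝒮 : Set (Finset Ordinal), (∀ A ∈ 𝒮, A.Nonempty ∧ ↑A ⊆ Set.Iio omegaOne) →
    ¬ 𝒮.Countable →
    {l : ℕ | ∃ D : ℕ → Finset Ordinal, (∀ i < T.n l, D i ∈ 𝒮) ∧
      (∀ i < T.n l, ∀ i' < T.n l, i ≠ i' → D i ≠ D i') ∧
      DeltaCapturedFam T ℱ (T.n l) D l}.Infinite

/-- `E` is an `n`-entangled subset of the linear order `X`. -/
def IsNEntangled {X : Type*} [LinearOrder X] (E : Set X) (n : ℕ) : Prop :=
  ¬ E.Countable ∧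
  ∀ τ : Fin n → Fin 2, ∀ 𝒜 : Set (Fin n → X),
    (∀ a ∈ 𝒜, StrictMono a ∧ ∀ i, a i ∈ E) →
    (𝒜.Pairwise fun a b => ∀ i j, a i ≠ b j) →
    ¬ 𝒜.Countable →
    ∃ a ∈ 𝒜, ∃ b ∈ 𝒜, a ≠ b ∧ ∀ i, (a i < b i ↔ τ i = 0)


universe u

/-- The number of elements of `F` below `α`. -/
def rankIn (F : Finset Ordinal.{u}) (α : Ordinal.{u}) : ℕ := (F.filter (· < α)).card

/-- The common value of `rankIn F α` for the members `F ∋ α` of `ℱ_k`. -/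
def levelRank (T : SchemeType) (ℱ : Set (Finset Ordinal.{u})) (k : ℕ) (α : Ordinal.{u}) : ℕ :=
  sInf {n | ∃ F ∈ ℱ, F.card = T.m k ∧ α ∈ F ∧ rankIn F α = n}

theorem SchemeType.strictMono_m (T : SchemeType) : StrictMono T.m := by
  refine strictMono_nat_of_lt_succ fun k => ?_
  have h1 := T.n_ge k
  have h2 := T.r_lt k
  rw [T.m_succ k]
  have : (T.m k - T.r (k + 1)) * 2 ≤ (T.m k - T.r (k + 1)) * T.n (k + 1) :=
    Nat.mul_le_mul_left _ h1
  omega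

section Decomposition

variable {T : SchemeType} {ℱ : Set (Finset Ordinal.{u})} {k i : ℕ} {F R : Finset Ordinal.{u}}
  {D : ℕ → Finset Ordinal.{u}} {α : Ordinal.{u}}

theorem IsDecomposition.root_subset (h : IsDecomposition T ℱ k F D R) (hi : i < T.n (k + 1)) :
    R ⊆ D i := by
  obtain ⟨-, -, -, h4, -⟩ := h
  have hn := T.n_ge k
  obtain ⟨j, hj, hij⟩ : ∃ j < T.n (k + 1), i ≠ j := by
    by_cases h0 : i = 0
    · exact ⟨1, by omega, by omega⟩
    · exact ⟨0, by omega, h0⟩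
  rw [← h4 i hi j hj hij]
  exact Finset.inter_subset_left

theorem IsDecomposition.mem_iff (h : IsDecomposition T ℱ k F D R) :
    α ∈ F ↔ ∃ i < T.n (k + 1), α ∈ D i := by
  rw [h.2.1]
  simp

theorem IsDecomposition.rankIn_of_mem_root (h : IsDecomposition T ℱ k F D R)
    (hi : i < T.n (k + 1)) (hα : α ∈ R) :
    rankIn F α = rankIn (D i) α ∧ rankIn (D i) α < T.r (k + 1) := by
  have hD : ∀ j < T.n (k + 1), (D j).filter (· < α) = R.filter (· < α) := by
    intro j hj
    ext x
    simp only [Finset.mem_filter, and_congr_left_iff]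
    intro hx
    refine ⟨fun hxD => ?_, fun hxR => h.root_subset hj hxR⟩
    by_contra hxR
    exact lt_asymm hx (h.2.2.2.2.1 j hj α hα x (Finset.mem_sdiff.2 ⟨hxD, hxR⟩))
  have hF : F.filter (· < α) = R.filter (· < α) := by
    ext x
    constructor
    · intro hx
      obtain ⟨hxF, hxα⟩ := Finset.mem_filter.1 hx
      obtain ⟨j, hj, hxj⟩ := h.mem_iff.1 hxF
      rw [← hD j hj]
      exact Finset.mem_filter.2 ⟨hxj, hxα⟩
    · intro hx
      obtain ⟨hxR, hxα⟩ := Finset.mem_filter.1 hx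
      exact Finset.mem_filter.2 ⟨h.mem_iff.2 ⟨i, hi, h.root_subset hi hxR⟩, hxα⟩
  unfold rankIn
  rw [hF, hD i hi, ← h.2.2.1]
  refine ⟨rfl, Finset.card_lt_card ?_⟩
  exact Finset.filter_ssubset.2 ⟨α, hα, lt_irrefl α⟩

theorem IsDecomposition.rankIn_of_notMem_root (h : IsDecomposition T ℱ k F D R)
    (hi : i < T.n (k + 1)) (hα : α ∈ D i) (hR : α ∉ R) :
    rankIn F α = rankIn (D i) α + i * (T.m k - T.r (k + 1)) ∧
      T.r (k + 1) ≤ rankIn (D i) α := by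
  have hαi : α ∈ D i \ R := Finset.mem_sdiff.2 ⟨hα, hR⟩
  have hsub : R ⊆ (D i).filter (· < α) := fun x hx =>
    Finset.mem_filter.2 ⟨h.root_subset hi hx, h.2.2.2.2.1 i hi x hx α hαi⟩
  have hF : F.filter (· < α) =
      (D i).filter (· < α) ∪ (Finset.range i).biUnion fun j => D j \ R := by
    ext x
    simp only [Finset.mem_union, Finset.mem_filter, Finset.mem_biUnion, Finset.mem_range]
    constructor
    · rintro ⟨hxF, hxα⟩
      obtain ⟨j, hj, hxj⟩ := h.mem_iff.1 hxF
      by_cases hxR : x ∈ R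
      · exact Or.inl ⟨h.root_subset hi hxR, hxα⟩
      have hxj' : x ∈ D j \ R := Finset.mem_sdiff.2 ⟨hxj, hxR⟩
      rcases lt_trichotomy j i with hji | rfl | hij
      · exact Or.inr ⟨j, hji, hxj'⟩
      · exact Or.inl ⟨hxj, hxα⟩
      · exact absurd (h.2.2.2.2.2 i j hij hj α hαi x hxj') (lt_asymm hxα)
    · rintro (⟨hxi, hxα⟩ | ⟨j, hji, hxj⟩)
      · exact ⟨h.mem_iff.2 ⟨i, hi, hxi⟩, hxα⟩
      · exact ⟨h.mem_iff.2 ⟨j, hji.trans hi, (Finset.mem_sdiff.1 hxj).1⟩,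
          h.2.2.2.2.2 j i hji hi x hxj α hαi⟩
  have hdisj : Disjoint ((D i).filter (· < α)) ((Finset.range i).biUnion fun j => D j \ R) := by
    rw [Finset.disjoint_left]
    intro x hx hx'
    obtain ⟨j, hj, hxj⟩ := Finset.mem_biUnion.1 hx'
    have hji := Finset.mem_range.1 hj
    obtain ⟨hxj, hxR⟩ := Finset.mem_sdiff.1 hxj
    apply hxR
    rw [← h.2.2.2.1 i hi j (hji.trans hi) hji.ne']
    exact Finset.mem_inter.2 ⟨(Finset.mem_filter.1 hx).1, hxj⟩
  have hcard : ((Finset.range i).biUnion fun j => D j \ R).card =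
      i * (T.m k - T.r (k + 1)) := by
    rw [Finset.card_biUnion]
    · rw [Finset.sum_congr rfl (g := fun _ => T.m k - T.r (k + 1))]
      · simp
      · intro j hj
        have hjn := (Finset.mem_range.1 hj).trans hi
        rw [Finset.card_sdiff_of_subset (h.root_subset hjn), (h.1 j hjn).2, h.2.2.1]
    · intro j hj j' hj' hne
      rw [Function.onFun, Finset.disjoint_left]
      intro x hx hx'
      obtain ⟨hxj, hxR⟩ := Finset.mem_sdiff.1 hx
      apply hxR
      rw [← h.2.2.2.1 j ((Finset.mem_range.1 hj).trans hi) j'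
        ((Finset.mem_range.1 hj').trans hi) hne]
      exact Finset.mem_inter.2 ⟨hxj, (Finset.mem_sdiff.1 hx').1⟩
  unfold rankIn
  rw [hF, Finset.card_union_of_disjoint hdisj, hcard]
  refine ⟨rfl, ?_⟩
  rw [← h.2.2.1]
  exact Finset.card_le_card hsub

end Decomposition

theorem infinite_Iio_omegaOne : (Set.Iio omegaOne.{u}).Infinite := by
  intro h
  have hle : Ordinal.omega0.{u} ≤ omegaOne := by
    rw [← Cardinal.ord_aleph0]
    exact Cardinal.ord_le_ord.2 (Cardinal.aleph0_le_aleph 1)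
  refine Set.infinite_of_injective_forall_mem (f := fun n : ℕ => (n : Ordinal.{u}))
    Nat.cast_injective (fun n => ?_) h
  exact (Ordinal.natCast_lt_omega0 n).trans_le hle

theorem not_countable_Iio_omegaOne : ¬ (Set.Iio omegaOne.{u}).Countable := by
  rw [← Cardinal.le_aleph0_iff_set_countable, Cardinal.mk_Iio_ordinal, omegaOne,
    Cardinal.card_ord, Cardinal.lift_le_aleph0, not_le]
  exact Cardinal.aleph0_lt_aleph_one

theorem succ_lt_omegaOne {α : Ordinal.{u}} (h : α < omegaOne) : Order.succ α < omegaOne :=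
  (Cardinal.isSuccLimit_ord (Cardinal.aleph0_le_aleph 1)).succ_lt h

section Scheme

variable {T : SchemeType} {ℱ : Set (Finset Ordinal.{u})} (hS : IsConstructionScheme T ℱ)
  {k l : ℕ} {E F : Finset Ordinal.{u}} {α β : Ordinal.{u}}

include hS

theorem IsConstructionScheme.exists_mem_subset (hkl : k ≤ l) (hF : F ∈ ℱ) (hc : F.card = T.m l)
    (hα : α ∈ F) : ∃ G ∈ ℱ, G.card = T.m k ∧ α ∈ G ∧ G ⊆ F := by
  induction l, hkl using Nat.le_induction generalizing F with
  | base => exact ⟨F, hF, hc, hα, subset_rfl⟩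
  | succ l _ ih =>
    obtain ⟨D, R, h⟩ := hS.decomp l F hF hc
    obtain ⟨i, hi, hαi⟩ := h.mem_iff.1 hα
    obtain ⟨G, hG, hGc, hαG, hGD⟩ := ih (h.1 i hi).1 (h.1 i hi).2 hαi
    exact ⟨G, hG, hGc, hαG, fun x hx => h.mem_iff.2 ⟨i, hi, hGD hx⟩⟩

theorem IsConstructionScheme.exists_mem (k : ℕ) (hα : α < omegaOne) :
    ∃ F ∈ ℱ, F.card = T.m k ∧ α ∈ F := by
  obtain ⟨A, hA, hAc⟩ := infinite_Iio_omegaOne.{u}.exists_subset_card_eq (T.m k)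
  obtain ⟨F, hF, hAF⟩ := hS.cofinal (insert α A) (by
    rw [Finset.coe_insert]
    exact Set.insert_subset hα hA)
  obtain ⟨l, hl⟩ := hS.card_eq F hF
  have hkl : T.m k ≤ T.m l := by
    rw [← hl, ← hAc]
    exact Finset.card_le_card ((Finset.subset_insert α A).trans hAF)
  obtain ⟨G, hG, hGc, hαG, -⟩ := hS.exists_mem_subset (T.strictMono_m.le_iff_le.1 hkl) hF hl
    (hAF (Finset.mem_insert_self α A))
  exact ⟨G, hG, hGc, hαG⟩

theorem IsConstructionScheme.mem_of_lt (hkl : k ≤ l) (hE : E ∈ ℱ) (hEc : E.card = T.m k)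
    (hF : F ∈ ℱ) (hFc : F.card = T.m l) (hβE : β ∈ E) (hβF : β ∈ F) (hα : α ∈ E)
    (hαβ : α < β) : α ∈ F := by
  obtain ⟨G, hG, hGc, hβG, hGF⟩ := hS.exists_mem_subset hkl hF hFc hβF
  have h := (hS.inter_initSeg k E hE G hG hEc hGc).1 β (Finset.mem_inter.2 ⟨hβE, hβG⟩) α hα hαβ
  exact hGF (Finset.mem_inter.1 h).2

theorem IsConstructionScheme.levelRank_eq (hF : F ∈ ℱ) (hFc : F.card = T.m k) (hα : α ∈ F) :
    levelRank T ℱ k α = rankIn F α := by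
  obtain ⟨G, hG, hGc, hαG, h⟩ := Nat.sInf_mem
    (s := {n | ∃ F ∈ ℱ, F.card = T.m k ∧ α ∈ F ∧ rankIn F α = n}) ⟨_, F, hF, hFc, hα, rfl⟩
  refine h.symm.trans (congrArg Finset.card ?_)
  ext x
  simp only [Finset.mem_filter, and_congr_left_iff]
  exact fun hx => ⟨fun hxG => hS.mem_of_lt le_rfl hG hGc hF hFc hαG hα hxG hx,
    fun hxF => hS.mem_of_lt le_rfl hF hFc hG hGc hα hαG hxF hx⟩

theorem IsConstructionScheme.Xi_succ_cases (k : ℕ) (hα : α < omegaOne) :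
    (levelRank T ℱ k α < T.r (k + 1) ∧ Xi T ℱ α (k + 1) = -1 ∧
      levelRank T ℱ (k + 1) α = levelRank T ℱ k α) ∨
    (T.r (k + 1) ≤ levelRank T ℱ k α ∧ ∃ i : ℕ, Xi T ℱ α (k + 1) = i ∧
      levelRank T ℱ (k + 1) α = levelRank T ℱ k α + i * (T.m k - T.r (k + 1))) := by
  by_cases h : ∃ i : ℕ, ∃ F ∈ ℱ, ∃ D R, F.card = T.m (k + 1) ∧ α ∈ F ∧
      IsDecomposition T ℱ (k + 1 - 1) F D R ∧ i < T.n (k + 1) ∧ α ∈ D i ∧ α ∉ R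
  · right
    have hXi : Xi T ℱ α (k + 1) = (h.choose : ℤ) := by
      rw [Xi, if_neg k.succ_ne_zero, dif_pos h]
    obtain ⟨F, hF, D, R, hFc, hαF, hD, hi, hαi, hαR⟩ := h.choose_spec
    rw [Nat.add_sub_cancel] at hD
    obtain ⟨h1, h2⟩ := hD.rankIn_of_notMem_root hi hαi hαR
    rw [← hS.levelRank_eq (hD.1 _ hi).1 (hD.1 _ hi).2 hαi] at h1 h2
    rw [← hS.levelRank_eq hF hFc hαF] at h1
    exact ⟨h2, _, hXi, h1⟩
  · left
    have hXi : Xi T ℱ α (k + 1) = -1 := by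
      rw [Xi, if_neg k.succ_ne_zero, dif_neg h]
    obtain ⟨F, hF, hFc, hαF⟩ := hS.exists_mem (k + 1) hα
    obtain ⟨D, R, hD⟩ := hS.decomp k F hF hFc
    obtain ⟨i, hi, hαi⟩ := hD.mem_iff.1 hαF
    have hαR : α ∈ R := by
      by_contra hαR
      exact h ⟨i, F, hF, D, R, hFc, hαF, hD, hi, hαi, hαR⟩
    obtain ⟨h1, h2⟩ := hD.rankIn_of_mem_root hi hαR
    rw [← hS.levelRank_eq (hD.1 _ hi).1 (hD.1 _ hi).2 hαi] at h1 h2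
    rw [← hS.levelRank_eq hF hFc hαF] at h1
    exact ⟨h2, hXi, h1⟩

theorem IsConstructionScheme.levelRank_zero (hα : α < omegaOne) : levelRank T ℱ 0 α = 0 := by
  obtain ⟨F, hF, hFc, hαF⟩ := hS.exists_mem 0 hα
  rw [hS.levelRank_eq hF hFc hαF, rankIn, Finset.card_eq_zero]
  rw [T.m_zero, Finset.card_eq_one] at hFc
  obtain ⟨x, rfl⟩ := hFc
  rw [Finset.mem_singleton] at hαF
  subst hαF
  simp [Finset.filter_singleton]

theorem IsConstructionScheme.levelRank_congr (hα : α < omegaOne) (hβ : β < omegaOne)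
    (h : ∀ j ≤ k, Xi T ℱ α j = Xi T ℱ β j) : levelRank T ℱ k α = levelRank T ℱ k β := by
  induction k with
  | zero => rw [hS.levelRank_zero hα, hS.levelRank_zero hβ]
  | succ k ih =>
    have hk := ih fun j hj => h j (hj.trans k.le_succ)
    have hX := h (k + 1) le_rfl
    rcases hS.Xi_succ_cases k hα with ⟨_, hα1, hα2⟩ | ⟨_, i, hα1, hα2⟩ <;>
      rcases hS.Xi_succ_cases k hβ with ⟨_, hβ1, hβ2⟩ | ⟨_, j, hβ1, hβ2⟩
    · rw [hα2, hβ2, hk]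
    · omega
    · omega
    · have hij : i = j := by omega
      rw [hα2, hβ2, hk, hij]

theorem IsConstructionScheme.Xi_injOn (hα : α < omegaOne) (hβ : β < omegaOne)
    (h : ∀ k, Xi T ℱ α k = Xi T ℱ β k) : α = β := by
  wlog hle : α ≤ β generalizing α β
  · exact (this hβ hα (fun k => (h k).symm) (le_of_not_ge hle)).symm
  by_contra hne
  have hlt := lt_of_le_of_ne hle hne
  obtain ⟨F, hF, hsub⟩ := hS.cofinal {α, β} (by
    intro x hx
    rcases Finset.mem_insert.1 (Finset.mem_coe.1 hx) with rfl | hx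
    · exact hα
    · rwa [Finset.mem_singleton.1 hx])
  obtain ⟨k, hk⟩ := hS.card_eq F hF
  have hαF : α ∈ F := hsub (by simp)
  have hβF : β ∈ F := hsub (by simp)
  have heq := hS.levelRank_congr (k := k) hα hβ fun j _ => h j
  rw [hS.levelRank_eq hF hk hαF, hS.levelRank_eq hF hk hβF] at heq
  refine heq.not_lt (Finset.card_lt_card ?_)
  rw [Finset.ssubset_iff_of_subset]
  · exact ⟨α, by simp [hαF, hlt], by simp⟩
  · intro x hx
    obtain ⟨hxF, hx⟩ := Finset.mem_filter.1 hx
    exact Finset.mem_filter.2 ⟨hxF, hx.trans hlt⟩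

theorem IsConstructionScheme.exists_levelRank_succ (hα : α < omegaOne) :
    ∃ k, ∀ l ≥ k, levelRank T ℱ l (Order.succ α) = levelRank T ℱ l α + 1 := by
  obtain ⟨E, hE, hsub⟩ := hS.cofinal {α, Order.succ α} (by
    intro x hx
    rcases Finset.mem_insert.1 (Finset.mem_coe.1 hx) with rfl | hx
    · exact hα
    · rw [Finset.mem_singleton.1 hx]
      exact succ_lt_omegaOne hα)
  obtain ⟨k, hk⟩ := hS.card_eq E hE
  refine ⟨k, fun l hl => ?_⟩
  obtain ⟨F, hF, hFc, hsF⟩ := hS.exists_mem l (succ_lt_omegaOne hα)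
  have hαF : α ∈ F := hS.mem_of_lt hl hE hk hF hFc (hsub (by simp)) hsF (hsub (by simp))
    (Order.lt_succ α)
  rw [hS.levelRank_eq hF hFc hsF, hS.levelRank_eq hF hFc hαF, rankIn, rankIn,
    ← Finset.card_insert_of_notMem (a := α) (by simp)]
  congr 1
  ext x
  simp only [Finset.mem_filter, Finset.mem_insert, Order.lt_succ_iff, le_iff_eq_or_lt]
  constructor
  · rintro ⟨hx, rfl | h⟩
    · exact Or.inl rfl
    · exact Or.inr ⟨hx, h⟩
  · rintro (rfl | ⟨hx, h⟩)
    · exact ⟨hαF, Or.inl rfl⟩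
    · exact ⟨hx, Or.inr h⟩

theorem IsConstructionScheme.Xi_order_succ (hα : α < omegaOne)
    (hk : levelRank T ℱ k (Order.succ α) = levelRank T ℱ k α + 1)
    (hk' : levelRank T ℱ (k + 1) (Order.succ α) = levelRank T ℱ (k + 1) α + 1) :
    Xi T ℱ (Order.succ α) (k + 1) =
      if levelRank T ℱ k α + 1 = T.r (k + 1) then 0 else Xi T ℱ α (k + 1) := by
  have hpos : 0 < T.m k - T.r (k + 1) := Nat.sub_pos_of_lt (T.r_lt k)
  rcases hS.Xi_succ_cases k hα with ⟨hα0, hα1, hα2⟩ | ⟨hα0, i, hα1, hα2⟩ <;>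
    rcases hS.Xi_succ_cases k (succ_lt_omegaOne hα) with ⟨hβ0, hβ1, hβ2⟩ | ⟨hβ0, j, hβ1, hβ2⟩
  · rw [if_neg (by omega), hα1, hβ1]
  · have hj : j * (T.m k - T.r (k + 1)) = 0 := by omega
    rcases Nat.mul_eq_zero.1 hj with rfl | h0
    · rw [if_pos (by omega), hβ1, Nat.cast_zero]
    · omega
  · omega
  · have hij : i = j := Nat.eq_of_mul_eq_mul_right hpos (by omega)
    rw [if_neg (by omega), hα1, hβ1, hij]

theorem IsConstructionScheme.toLex_Xi_succ_lt (hα : α < omegaOne) (hβ : β < omegaOne)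
    (hkα : ∀ l ≥ k, levelRank T ℱ l (Order.succ α) = levelRank T ℱ l α + 1)
    (hkβ : ∀ l ≥ k, levelRank T ℱ l (Order.succ β) = levelRank T ℱ l β + 1)
    (h : ∀ j ≤ k, Xi T ℱ α j = Xi T ℱ β j)
    (h' : ∀ j ≤ k, Xi T ℱ (Order.succ α) j = Xi T ℱ (Order.succ β) j)
    (hlt : toLex (fun j => Xi T ℱ α j) < toLex (fun j => Xi T ℱ β j)) :
    toLex (fun j => Xi T ℱ (Order.succ α) j) < toLex (fun j => Xi T ℱ (Order.succ β) j) := by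
  obtain ⟨d, hd, hdlt⟩ := hlt
  change ∀ j < d, Xi T ℱ α j = Xi T ℱ β j at hd
  change Xi T ℱ α d < Xi T ℱ β d at hdlt
  have hkd : k < d := by
    by_contra hkd
    exact hdlt.ne (h d (not_lt.1 hkd))
  refine ⟨d, fun j hj => ?_, ?_⟩
  · change Xi T ℱ (Order.succ α) j = Xi T ℱ (Order.succ β) j
    rcases le_or_gt j k with hjk | hkj
    · exact h' j hjk
    obtain ⟨l, rfl⟩ : ∃ l, j = l + 1 := ⟨j - 1, by omega⟩
    rw [hS.Xi_order_succ hα (hkα l (by omega)) (hkα (l + 1) (by omega)),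
      hS.Xi_order_succ hβ (hkβ l (by omega)) (hkβ (l + 1) (by omega)),
      hS.levelRank_congr hα hβ fun i hi => hd i (by omega), hd _ hj]
  · change Xi T ℱ (Order.succ α) d < Xi T ℱ (Order.succ β) d
    obtain ⟨l, rfl⟩ : ∃ l, d = l + 1 := ⟨d - 1, by omega⟩
    have hr := hS.levelRank_congr (k := l) hα hβ fun i hi => hd i (by omega)
    have hne : levelRank T ℱ l β + 1 ≠ T.r (l + 1) := by
      intro he
      rcases hS.Xi_succ_cases l hα with ⟨_, hα1, _⟩ | ⟨_, _⟩ <;>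
        rcases hS.Xi_succ_cases l hβ with ⟨_, hβ1, _⟩ | ⟨_, _⟩ <;> omega
    rw [hS.Xi_order_succ hα (hkα l (by omega)) (hkα (l + 1) (by omega)),
      hS.Xi_order_succ hβ (hkβ l (by omega)) (hkβ (l + 1) (by omega)), hr, if_neg hne,
      if_neg hne]
    exact hdlt

theorem IsConstructionScheme.exists_uncountable_pairs :
    ∃ 𝒜 : Set (Fin 2 → Lex (ℕ → ℤ)),
      (∀ a ∈ 𝒜, StrictMono a ∧
        ∀ i, a i ∈ (fun α => toLex (fun k => Xi T ℱ α k)) '' Set.Iio omegaOne.{u}) ∧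
      (𝒜.Pairwise fun a b => ∀ i j, a i ≠ b j) ∧
      ¬ 𝒜.Countable ∧
      ∀ a ∈ 𝒜, ∀ b ∈ 𝒜, a ≠ b → (a 0 < b 0 ↔ a 1 < b 1) := by
  set Ξ : Ordinal.{u} → Lex (ℕ → ℤ) := fun α => toLex (fun k => Xi T ℱ α k)
  have hinj : ∀ {α β}, α < omegaOne.{u} → β < omegaOne.{u} → Ξ α = Ξ β → α = β :=
    fun hα hβ h => hS.Xi_injOn hα hβ fun k => congrFun (congrArg ofLex h) k
  choose! κ hκ using fun (α : Ordinal.{u}) (hα : α < omegaOne.{u}) =>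
    hS.exists_levelRank_succ hα
  let code : Ordinal.{u} → ℕ × List ℤ × List ℤ × Bool := fun α =>
    (κ α, (List.range (κ α + 1)).map (Xi T ℱ α),
      (List.range (κ α + 1)).map (Xi T ℱ (Order.succ α)), decide (Ξ α < Ξ (Order.succ α)))
  obtain ⟨⟨k, L, L', s⟩, hc⟩ : ∃ c, ¬ (Set.Iio omegaOne.{u} ∩ code ⁻¹' {c}).Countable := by
    by_contra! hcon
    refine not_countable_Iio_omegaOne.{u} ((Set.countable_iUnion hcon).mono fun α hα => ?_)
    exact Set.mem_iUnion.2 ⟨code α, hα, rfl⟩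
  set S := Set.Iio omegaOne.{u} ∩ code ⁻¹' {(k, L, L', s)}
  have hsucc : ∀ α ∈ S, Order.succ α < omegaOne := fun α hα => succ_lt_omegaOne hα.1
  have hcode : ∀ α ∈ S, κ α = k ∧ (List.range (k + 1)).map (Xi T ℱ α) = L ∧
      (List.range (k + 1)).map (Xi T ℱ (Order.succ α)) = L' ∧
      decide (Ξ α < Ξ (Order.succ α)) = s := by
    rintro α ⟨-, hα⟩
    simp only [code, Set.mem_preimage, Set.mem_singleton_iff, Prod.mk.injEq] at hα
    obtain ⟨h1, h2, h3, h4⟩ := hα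
    subst h1
    exact ⟨rfl, h2, h3, h4⟩
  have hrank : ∀ α ∈ S, ∀ l ≥ k, levelRank T ℱ l (Order.succ α) = levelRank T ℱ l α + 1 := by
    intro α hα
    rw [← (hcode α hα).1]
    exact hκ α hα.1
  have hagree : ∀ α ∈ S, ∀ β ∈ S, ∀ j ≤ k, Xi T ℱ α j = Xi T ℱ β j := by
    intro α hα β hβ j hj
    exact List.map_inj_left.1 ((hcode α hα).2.1.trans (hcode β hβ).2.1.symm) j
      (List.mem_range.2 (by omega))
  have hagree' : ∀ α ∈ S, ∀ β ∈ S, ∀ j ≤ k,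
      Xi T ℱ (Order.succ α) j = Xi T ℱ (Order.succ β) j := by
    intro α hα β hβ j hj
    exact List.map_inj_left.1 ((hcode α hα).2.2.1.trans (hcode β hβ).2.2.1.symm) j
      (List.mem_range.2 (by omega))
  have hnsucc : ∀ α ∈ S, ∀ β ∈ S, Ξ α ≠ Ξ (Order.succ β) := by
    intro α hα β hβ he
    have h1 := hS.levelRank_congr (k := k) hα.1 hβ.1 (hagree α hα β hβ)
    have h2 := hrank β hβ k le_rfl
    rw [← hinj hα.1 (hsucc β hβ) he] at h2
    omega
  have hstep : ∀ α ∈ S, ∀ β ∈ S, Ξ α < Ξ β → Ξ (Order.succ α) < Ξ (Order.succ β) :=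
    fun α hα β hβ => hS.toLex_Xi_succ_lt hα.1 hβ.1 (hrank α hα) (hrank β hβ)
      (hagree α hα β hβ) (hagree' α hα β hβ)
  have hiff : ∀ α ∈ S, ∀ β ∈ S, (Ξ α < Ξ β ↔ Ξ (Order.succ α) < Ξ (Order.succ β)) := by
    intro α hα β hβ
    refine ⟨hstep α hα β hβ, fun h => ?_⟩
    rcases lt_trichotomy (Ξ α) (Ξ β) with h' | h' | h'
    · exact h'
    · rw [hinj hα.1 hβ.1 h'] at h
      exact absurd h (lt_irrefl _)
    · exact absurd h (lt_asymm (hstep β hβ α hα h'))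
  have hΞsucc : ∀ α ∈ S, ∀ β ∈ S, Ξ (Order.succ α) = Ξ (Order.succ β) → α = β :=
    fun α hα β hβ h => Order.succ_injective (hinj (hsucc α hα) (hsucc β hβ) h)
  let p : Ordinal.{u} → Fin 2 → Lex (ℕ → ℤ) := fun α =>
    if s then ![Ξ α, Ξ (Order.succ α)] else ![Ξ (Order.succ α), Ξ α]
  have hp : ∀ α ∈ S, ∀ β ∈ S, α ≠ β → ∀ i j, p α i ≠ p β j := by
    intro α hα β hβ hne i j
    have h1 : Ξ α ≠ Ξ β := fun h => hne (hinj hα.1 hβ.1 h)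
    have h2 : Ξ (Order.succ α) ≠ Ξ (Order.succ β) := fun h => hne (hΞsucc α hα β hβ h)
    have h3 := hnsucc α hα β hβ
    have h4 := (hnsucc β hβ α hα).symm
    cases s <;> fin_cases i <;> fin_cases j <;> simpa [p]
  refine ⟨p '' S, ?_, ?_, ?_, ?_⟩
  · rintro _ ⟨α, hα, rfl⟩
    have hs := (hcode α hα).2.2.2
    refine ⟨?_, fun i => ?_⟩
    · rw [Fin.strictMono_iff_lt_succ]
      intro i
      fin_cases i
      cases s
      · have hle := not_lt.1 (decide_eq_false_iff_not.1 hs)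
        have := lt_of_le_of_ne hle (hnsucc α hα α hα).symm
        simpa [p]
      · have := decide_eq_true_iff.1 hs
        simpa [p]
    · have h1 : Ξ α ∈ Ξ '' Set.Iio omegaOne.{u} := ⟨α, hα.1, rfl⟩
      have h2 : Ξ (Order.succ α) ∈ Ξ '' Set.Iio omegaOne.{u} := ⟨_, hsucc α hα, rfl⟩
      cases s <;> fin_cases i <;> simp only [p] <;> assumption
  · rintro _ ⟨α, hα, rfl⟩ _ ⟨β, hβ, rfl⟩ hne
    exact hp α hα β hβ fun h => hne (congrArg p h)
  · intro hcount
    refine hc (Set.countable_of_injective_of_countable_image ?_ hcount)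
    intro α hα β hβ h
    by_contra hne
    exact hp α hα β hβ hne 0 0 (congrFun h 0)
  · rintro _ ⟨α, hα, rfl⟩ _ ⟨β, hβ, rfl⟩ -
    have h := hiff α hα β hβ
    cases s
    · simpa [p] using h.symm
    · simpa [p] using h

end Scheme

/-- For any construction scheme `ℱ`, `α ↦ Ξ_α` is injective on `ω₁` and the uncountable set
`𝔼^ℱ = {Ξ_α : α < ω₁}`, with the lexicographic order on `ℤ^ω`, is not 2-entangled: there is an
uncountable family of pairwise disjoint 2-element subsets of `𝔼^ℱ` no two distinct members of
which realize the type `(0,1)` nor the type `(1,0)`. -/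
theorem stmt8 (T : SchemeType) (ℱ : Set (Finset Ordinal))
    (hS : IsConstructionScheme T ℱ) :
    (∀ α < omegaOne, ∀ β < omegaOne,
      (fun k => Xi T ℱ α k) = (fun k => Xi T ℱ β k) → α = β) ∧
    ¬ IsNEntangled ((fun α => toLex (fun k => Xi T ℱ α k)) '' Set.Iio omegaOne) 2 ∧
    ∃ 𝒜 : Set (Fin 2 → Lex (ℕ → ℤ)),
      (∀ a ∈ 𝒜, StrictMono a ∧
        ∀ i, a i ∈ (fun α => toLex (fun k => Xi T ℱ α k)) '' Set.Iio omegaOne) ∧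
      (𝒜.Pairwise fun a b => ∀ i j, a i ≠ b j) ∧
      ¬ 𝒜.Countable ∧
      ∀ a ∈ 𝒜, ∀ b ∈ 𝒜, a ≠ b →
        ¬ (∀ i : Fin 2, a i < b i ↔ i = 0) ∧ ¬ (∀ i : Fin 2, a i < b i ↔ i = 1) := by
  obtain ⟨𝒜, hE, hdisj, hunc, hiff⟩ := hS.exists_uncountable_pairs
  have htype : ∀ a ∈ 𝒜, ∀ b ∈ 𝒜, a ≠ b →
      ¬ (∀ i : Fin 2, a i < b i ↔ i = 0) ∧ ¬ (∀ i : Fin 2, a i < b i ↔ i = 1) := by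
    intro a ha b hb hne
    have h := hiff a ha b hb hne
    refine ⟨fun hτ => ?_, fun hτ => ?_⟩
    · exact absurd ((hτ 1).1 (h.1 ((hτ 0).2 rfl))) (by decide)
    · exact absurd ((hτ 0).1 (h.2 ((hτ 1).2 rfl))) (by decide)
  refine ⟨fun α hα β hβ h => hS.Xi_injOn hα hβ fun k => congrFun h k, ?_,
    𝒜, hE, hdisj, hunc, htype⟩
  rintro ⟨-, h⟩
  obtain ⟨a, ha, b, hb, hne, hτ⟩ := h id 𝒜 hE hdisj hunc
  exact (htype a ha b hb hne).1 hτ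

end
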